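/- Let D = {(x, y) ∈ ℝ × ℝ : x⁴ + 2x²y² + y⁴ + x³ − xy² = 0, 0 ≤ x, 0 ≤ y, and √3·x ≤ y}. Then D cannot be written as a finite union of special stable subsets of ℝ × ℝ. -/

import Mathlib

open Set MvPolynomial MeasureTheory
open scoped ENNReal

/-- A relation `D ⊆ S × T` is stable if there is no half-graph witness. -/
def IsStable {S T : Type*} (D : Set (S × T)) : Prop :=
  ¬ ∃ (a : ℕ → S) (b : ℕ → T), ∀ i j : ℕ, (a i, b j) ∈ D ↔ i ≤ j

/-- Semialgebraic subsets of ℝ^k: the Boolean algebra generated by the sets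
`{v | p v = 0}` and `{v | p v > 0}` for real polynomials `p`. -/
inductive Semialgebraic (k : ℕ) : Set (Fin k → ℝ) → Prop
  | zero (p : MvPolynomial (Fin k) ℝ) : Semialgebraic k {v | eval v p = 0}
  | pos (p : MvPolynomial (Fin k) ℝ) : Semialgebraic k {v | 0 < eval v p}
  | compl {s : Set (Fin k → ℝ)} : Semialgebraic k s → Semialgebraic k sᶜ
  | union {s t : Set (Fin k → ℝ)} :
      Semialgebraic k s → Semialgebraic k t → Semialgebraic k (s ∪ t)

/-- Equationally definable subsets of ℝ^k: the Boolean algebra generated by real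
algebraic sets `{v | p v = 0}`. -/
inductive EquationallyDefinable (k : ℕ) : Set (Fin k → ℝ) → Prop
  | zero (p : MvPolynomial (Fin k) ℝ) : EquationallyDefinable k {v | eval v p = 0}
  | compl {s : Set (Fin k → ℝ)} : EquationallyDefinable k s → EquationallyDefinable k sᶜ
  | union {s t : Set (Fin k → ℝ)} :
      EquationallyDefinable k s → EquationallyDefinable k t →
      EquationallyDefinable k (s ∪ t)

/-- The identification of ℝ^{a+b} with ℝ^a × ℝ^b. -/
def joinR (a b : ℕ) : (Fin (a + b) → ℝ) → (Fin a → ℝ) × (Fin b → ℝ) :=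
  fun v => (fun i => v (Fin.castAdd b i), fun j => v (Fin.natAdd a j))

/-- A subset of ℝ^m × ℝ^n is semialgebraic if the corresponding subset of ℝ^{m+n} is. -/
def SemialgebraicProd (m n : ℕ) (D : Set ((Fin m → ℝ) × (Fin n → ℝ))) : Prop :=
  Semialgebraic (m + n) (joinR m n ⁻¹' D)

/-- A subset of ℝ^m × ℝ^n is equationally definable if the corresponding subset of
ℝ^{m+n} is. -/
def EquationallyDefinableProd (m n : ℕ) (D : Set ((Fin m → ℝ) × (Fin n → ℝ))) : Prop :=
  EquationallyDefinable (m + n) (joinR m n ⁻¹' D)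

/-- `D ⊆ ℝ^m × ℝ^n` is special stable if `D = Z ∩ (X × Y)` with `Z` equationally
definable, `X ⊆ ℝ^m` and `Y ⊆ ℝ^n` semialgebraic. -/
def SpecialStable (m n : ℕ) (D : Set ((Fin m → ℝ) × (Fin n → ℝ))) : Prop :=
  ∃ (Z : Set ((Fin m → ℝ) × (Fin n → ℝ))) (X : Set (Fin m → ℝ)) (Y : Set (Fin n → ℝ)),
    EquationallyDefinableProd m n Z ∧ Semialgebraic m X ∧ Semialgebraic n Y ∧
    D = Z ∩ X ×ˢ Y

/-- The curve segment of Example 1.3: the part of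
`x⁴ + 2x²y² + y⁴ + x³ − xy² = 0` with `0 ≤ x`, `0 ≤ y` and `√3·x ≤ y`,
viewed as a subset of ℝ¹ × ℝ¹. -/
def exampleCurve : Set ((Fin 1 → ℝ) × (Fin 1 → ℝ)) :=
  {p | (p.1 0) ^ 4 + 2 * (p.1 0) ^ 2 * (p.2 0) ^ 2 + (p.2 0) ^ 4
        + (p.1 0) ^ 3 - (p.1 0) * (p.2 0) ^ 2 = 0 ∧
      0 ≤ p.1 0 ∧ 0 ≤ p.2 0 ∧ Real.sqrt 3 * p.1 0 ≤ p.2 0}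

/-- A one-variable semialgebraic set contains or misses a right punctured neighbourhood of `0`. -/
lemma Semialgebraic.eventually_mem_or_eventually_notMem {S : Set (Fin 1 → ℝ)}
    (hS : Semialgebraic 1 S) :
    (∀ᶠ t in nhdsWithin (0 : ℝ) (Ioi 0), (fun _ => t) ∈ S) ∨
      (∀ᶠ t in nhdsWithin (0 : ℝ) (Ioi 0), (fun _ => t) ∉ S) := by
  have factor (p : MvPolynomial (Fin 1) ℝ) :
      (∀ t : ℝ, eval (fun _ => t) p = 0) ∨
      (∀ᶠ t in nhdsWithin (0 : ℝ) (Ioi 0), 0 < eval (fun _ => t) p) ∨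
      (∀ᶠ t in nhdsWithin (0 : ℝ) (Ioi 0), eval (fun _ => t) p < 0) := by
    set q : Polynomial ℝ := aeval (fun _ => Polynomial.X) p with hq
    have hev (t : ℝ) : eval (fun _ => t) p = q.eval t := by
      rw [hq, ← Polynomial.coe_evalRingHom, aeval_def, Polynomial.algebraMap_eq, hom_eval₂]
      have hC : (Polynomial.evalRingHom t).comp Polynomial.C = RingHom.id ℝ := by
        ext; simp
      rw [hC, eval₂_id]
      simp
    simp_rw [hev]
    by_cases h0 : q = 0
    · simp [h0]
    right
    obtain ⟨r, hr, hnd⟩ := Polynomial.exists_eq_pow_rootMultiplicity_mul_and_not_dvd q h0 0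
    simp only [Polynomial.C_0, sub_zero, Polynomial.X_dvd_iff,
      Polynomial.coeff_zero_eq_eval_zero] at hr hnd
    have hcont : Filter.Tendsto (fun t => r.eval t) (nhdsWithin 0 (Ioi 0)) (nhds (r.eval 0)) :=
      r.continuous.continuousAt.mono_left nhdsWithin_le_nhds
    rw [hr]
    rcases lt_or_gt_of_ne hnd with h | h
    · right
      filter_upwards [hcont.eventually_lt_const h, self_mem_nhdsWithin] with t ht hpos
      simpa using mul_neg_of_pos_of_neg (pow_pos hpos _) ht
    · left
      filter_upwards [hcont.eventually_const_lt h, self_mem_nhdsWithin] with t ht hpos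
      simpa using mul_pos (pow_pos hpos _) ht
  induction hS with
  | zero p =>
    rcases factor p with h | h | h
    · exact Or.inl (Filter.Eventually.of_forall h)
    · exact Or.inr (h.mono fun _ ht => ht.ne')
    · exact Or.inr (h.mono fun _ ht => ht.ne)
  | pos p =>
    rcases factor p with h | h | h
    · exact Or.inr (Filter.Eventually.of_forall fun t => (h t).not_gt)
    · exact Or.inl h
    · exact Or.inr (h.mono fun _ ht => ht.not_gt)
  | compl _ ih =>
    rcases ih with h | h
    · exact Or.inr (h.mono fun _ ht => not_not_intro ht)
    · exact Or.inl h
  | union _ _ ih₁ ih₂ =>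
    rcases ih₁ with h₁ | h₁
    · exact Or.inl (h₁.mono fun _ ht => Or.inl ht)
    rcases ih₂ with h₂ | h₂
    · exact Or.inl (h₂.mono fun _ ht => Or.inr ht)
    · exact Or.inr ((h₁.and h₂).mono fun _ ht => not_or.2 ht)

/-- Membership in an equationally definable set along an analytic curve is constant off a
discrete set of parameters. -/
lemma EquationallyDefinable.codiscrete_mem_or_notMem {k : ℕ} {Z : Set (Fin k → ℝ)}
    (hZ : EquationallyDefinable k Z) {c : ℝ → Fin k → ℝ}
    (hc : ∀ i, AnalyticOnNhd ℝ (fun t => c t i) univ) :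
    (∀ᶠ t in Filter.codiscrete ℝ, c t ∈ Z) ∨ (∀ᶠ t in Filter.codiscrete ℝ, c t ∉ Z) := by
  induction hZ with
  | zero p =>
    have hp : AnalyticOnNhd ℝ (fun t => eval (c t) p) univ := by
      simpa using AnalyticOnNhd.aeval_mvPolynomial hc p
    rcases hp.eqOn_zero_or_eventually_ne_zero_of_preconnected isPreconnected_univ with h | h
    · exact Or.inl (Filter.Eventually.of_forall fun t => h (mem_univ t))
    · exact Or.inr h
  | compl _ ih =>
    rcases ih with h | h
    · exact Or.inr (h.mono fun _ ht => not_not_intro ht)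
    · exact Or.inl h
  | union _ _ ih₁ ih₂ =>
    rcases ih₁ with h₁ | h₁
    · exact Or.inl (h₁.mono fun _ ht => Or.inl ht)
    rcases ih₂ with h₂ | h₂
    · exact Or.inl (h₂.mono fun _ ht => Or.inr ht)
    · exact Or.inr ((h₁.and h₂).mono fun _ ht => not_or.2 ht)

/-- Abscissa of the point of the curve of `exampleCurve` on the line `x = t * y`. -/
noncomputable def curveX (t : ℝ) : ℝ := t ^ 2 * (1 - t ^ 2) / (1 + t ^ 2) ^ 2

/-- Ordinate of the point of the curve of `exampleCurve` on the line `x = t * y`. -/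
noncomputable def curveY (t : ℝ) : ℝ := t * (1 - t ^ 2) / (1 + t ^ 2) ^ 2

lemma curveX_eq_mul_curveY (t : ℝ) : curveX t = t * curveY t := by
  unfold curveX curveY; ring

lemma curveX_pos {t : ℝ} (h0 : 0 < t) (h1 : t < 1) : 0 < curveX t := by
  have : 0 < 1 - t ^ 2 := by nlinarith
  unfold curveX; positivity

lemma curveY_pos {t : ℝ} (h0 : 0 < t) (h1 : t < 1) : 0 < curveY t := by
  have : 0 < 1 - t ^ 2 := by nlinarith
  unfold curveY; positivity

lemma analyticOnNhd_curveX : AnalyticOnNhd ℝ curveX univ := by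
  intro t _
  have : (1 + t ^ 2) ^ 2 ≠ 0 := by positivity
  unfold curveX
  fun_prop (disch := assumption)

lemma analyticOnNhd_curveY : AnalyticOnNhd ℝ curveY univ := by
  intro t _
  have : (1 + t ^ 2) ^ 2 ≠ 0 := by positivity
  unfold curveY
  fun_prop (disch := assumption)

lemma continuous_curveX : Continuous curveX := by
  rw [← continuousOn_univ]; exact analyticOnNhd_curveX.continuousOn

lemma continuous_curveY : Continuous curveY := by
  rw [← continuousOn_univ]; exact analyticOnNhd_curveY.continuousOn

lemma mem_exampleCurve_iff {t : ℝ} (h0 : 0 < t) (h1 : t < 1) :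
    ((fun _ => curveX t, fun _ => curveY t) : (Fin 1 → ℝ) × (Fin 1 → ℝ)) ∈ exampleCurve ↔
      Real.sqrt 3 * t ≤ 1 := by
  have hy := curveY_pos h0 h1
  have heq : curveX t ^ 4 + 2 * curveX t ^ 2 * curveY t ^ 2 + curveY t ^ 4 + curveX t ^ 3
      - curveX t * curveY t ^ 2 = 0 := by
    unfold curveX curveY
    field_simp
    ring
  simp only [exampleCurve, mem_ofPred_eq, heq, (curveX_pos h0 h1).le, hy.le, true_and]
  rw [curveX_eq_mul_curveY, ← mul_assoc]
  exact mul_le_iff_le_one_left hy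

lemma tendsto_curveX_curveY_zero {a : ℝ} (s : Set ℝ) (hs : ∀ᶠ t in nhdsWithin a s, 0 < t ∧ t < 1)
    (hX : curveX a = 0) (hY : curveY a = 0) :
    Filter.Tendsto curveX (nhdsWithin a s) (nhdsWithin 0 (Ioi 0)) ∧
      Filter.Tendsto curveY (nhdsWithin a s) (nhdsWithin 0 (Ioi 0)) := by
  constructor
  · refine tendsto_nhdsWithin_iff.2 ⟨?_, hs.mono fun t ht => curveX_pos ht.1 ht.2⟩
    simpa [hX] using continuous_curveX.continuousAt.mono_left (nhdsWithin_le_nhds (a := a))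
  · refine tendsto_nhdsWithin_iff.2 ⟨?_, hs.mono fun t ht => curveY_pos ht.1 ht.2⟩
    simpa [hY] using continuous_curveY.continuousAt.mono_left (nhdsWithin_le_nhds (a := a))

/-- A special stable set containing points of the curve arbitrarily close to the origin on the
branch with vertical tangent contains all points close enough to the origin on the branch
tangent to the diagonal. -/
lemma SpecialStable.eventually_curve_mem {S : Set ((Fin 1 → ℝ) × (Fin 1 → ℝ))}
    (hS : SpecialStable 1 1 S)
    (h : ∃ᶠ t in nhdsWithin (0 : ℝ) (Ioi 0), (fun _ => curveX t, fun _ => curveY t) ∈ S) :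
    ∀ᶠ t in nhdsWithin (1 : ℝ) (Iio 1), (fun _ => curveX t, fun _ => curveY t) ∈ S := by
  obtain ⟨Z, X, Y, hZ, hX, hY, rfl⟩ := hS
  have h01 : ∀ᶠ t in nhdsWithin (0 : ℝ) (Ioi 0), 0 < t ∧ t < 1 := Ioo_mem_nhdsGT one_pos
  have h10 : ∀ᶠ t in nhdsWithin (1 : ℝ) (Iio 1), 0 < t ∧ t < 1 := Ioo_mem_nhdsLT one_pos
  obtain ⟨tX0, tY0⟩ := tendsto_curveX_curveY_zero _ h01 (by simp [curveX]) (by simp [curveY])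
  obtain ⟨tX1, tY1⟩ := tendsto_curveX_curveY_zero _ h10 (by simp [curveX]) (by simp [curveY])
  have hXe := hX.eventually_mem_or_eventually_notMem.resolve_right fun hn =>
    h ((tX0.eventually hn).mono fun _ ht hm => ht hm.2.1)
  have hYe := hY.eventually_mem_or_eventually_notMem.resolve_right fun hn =>
    h ((tY0.eventually hn).mono fun _ ht hm => ht hm.2.2)
  have hle (a : ℝ) : nhdsWithin a {a}ᶜ ≤ Filter.codiscrete ℝ := fun s hs => by
    simpa [Filter.disjoint_principal_right] using mem_codiscrete.1 hs a
  have hjoin (t : ℝ) : joinR 1 1 (Fin.append (fun _ => curveX t) (fun _ => curveY t)) =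
      (fun _ => curveX t, fun _ => curveY t) := by
    simp only [joinR, Fin.append_left, Fin.append_right]
  have hZe := (EquationallyDefinable.codiscrete_mem_or_notMem hZ
    (c := fun t => Fin.append (fun _ => curveX t) (fun _ => curveY t)) (fun i => by
      refine Fin.addCases (fun i => ?_) (fun i => ?_) i
      · simpa only [Fin.append_left] using analyticOnNhd_curveX
      · simpa only [Fin.append_right] using analyticOnNhd_curveY))
  simp only [mem_preimage, hjoin] at hZe
  have hZe' := hZe.resolve_right fun hn =>
    h ((hn.filter_mono ((nhdsWithin_mono _ fun _ hx => ne_of_gt hx).trans (hle 0))).mono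
      fun _ ht hm => ht hm.1)
  filter_upwards [tX1.eventually hXe, tY1.eventually hYe,
    hZe'.filter_mono ((nhdsWithin_mono _ fun _ hx => ne_of_lt hx).trans (hle 1))] with t h1 h2 h3
  exact ⟨h3, h1, h2⟩

theorem stmt13 :
    ¬ ∃ (k : ℕ) (S : Fin k → Set ((Fin 1 → ℝ) × (Fin 1 → ℝ))),
      (∀ i, SpecialStable 1 1 (S i)) ∧ exampleCurve = ⋃ i, S i := by
  rintro ⟨k, S, hS, hD⟩
  have hin : ∀ᶠ t in nhdsWithin (0 : ℝ) (Ioi 0),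
      ∃ i, (fun _ => curveX t, fun _ => curveY t) ∈ S i := by
    filter_upwards [Ioo_mem_nhdsGT (show (0 : ℝ) < 1 / 2 by norm_num)] with t ht
    rw [← mem_iUnion, ← hD, mem_exampleCurve_iff ht.1 (by linarith [ht.2])]
    have : Real.sqrt 3 ≤ 2 := Real.sqrt_le_iff.2 (by norm_num)
    nlinarith [ht.1, ht.2]
  obtain ⟨i, hi⟩ : ∃ i, ∃ᶠ t in nhdsWithin (0 : ℝ) (Ioi 0),
      (fun _ => curveX t, fun _ => curveY t) ∈ S i := by
    by_contra! hn
    have hall := Filter.eventually_all.2 hn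
    obtain ⟨t, ⟨i, hi⟩, ht⟩ := (hin.and hall).exists
    exact ht i hi
  obtain ⟨t, htS, ht⟩ := (((hS i).eventually_curve_mem hi).and
    (Ioo_mem_nhdsLT (show (9 / 10 : ℝ) < 1 by norm_num))).exists
  have hmem : ((fun _ => curveX t, fun _ => curveY t) : (Fin 1 → ℝ) × (Fin 1 → ℝ)) ∈
      exampleCurve := hD ▸ mem_iUnion.2 ⟨i, htS⟩
  rw [mem_exampleCurve_iff (by linarith [ht.1]) ht.2] at hmem
  have : (3 / 2 : ℝ) ≤ Real.sqrt 3 := Real.le_sqrt_of_sq_le (by norm_num)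
  nlinarith [ht.1]
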